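/- arXiv:2504.07663 — 2 statements merged into one kernel-verified Lean document; each statement's English description precedes it below -/
import Mathlib

section
/- Let k ∈ ℕ and let (x̄, ȳ) be an extreme point of P(k) that is not integral. Then there exist λ ∈ (0, 1), permutations π_A, π_B of Fin n, and sets A, B ⊆ Fin n with |A| < k < |B| such that (x̄, ȳ) = λ · χ(π_A, A) + (1 − λ) · χ(π_B, B). -/
open Finset

noncomputable section

/-- Cost of the assignment `π` (customer `j` is assigned to supplier `π j`)
when the suppliers in `A` are upgraded. -/
def assignCost {n : ℕ} (b c d : Fin n → ℝ) (A : Finset (Fin n))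
    (π : Equiv.Perm (Fin n)) : ℝ :=
  ∑ j, (if π j ∈ A then b (π j) else c (π j)) * d j

/-- `cost A` : minimum assignment cost when upgrading the suppliers in `A`. -/
def cost {n : ℕ} (b c d : Fin n → ℝ) (A : Finset (Fin n)) : ℝ :=
  Finset.univ.inf' Finset.univ_nonempty (assignCost b c d A)

/-- The LP feasible region `P(k)`. -/
def Pk (n k : ℕ) : Set ((Fin n → Fin n → ℝ) × (Fin n → Fin n → ℝ)) :=
  {p | (∀ i j, 0 ≤ p.1 i j) ∧ (∀ i j, 0 ≤ p.2 i j) ∧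
    (∀ j, ∑ i, (p.1 i j + p.2 i j) = 1) ∧
    (∀ i, ∑ j, (p.1 i j + p.2 i j) = 1) ∧
    (∑ i, ∑ j, p.1 i j) ≤ (k : ℝ)}

/-- The LP objective. -/
def obj {n : ℕ} (b c d : Fin n → ℝ)
    (p : (Fin n → Fin n → ℝ) × (Fin n → Fin n → ℝ)) : ℝ :=
  ∑ i, ∑ j, (b i * p.1 i j + c i * p.2 i j) * d j

/-- A point is integral if all of its entries lie in `{0, 1}`. -/
def Integral {n : ℕ} (p : (Fin n → Fin n → ℝ) × (Fin n → Fin n → ℝ)) : Prop :=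
  (∀ i j, p.1 i j = 0 ∨ p.1 i j = 1) ∧ (∀ i j, p.2 i j = 0 ∨ p.2 i j = 1)

/-- `f_{A,B}(k)`. -/
def fpair {n : ℕ} (b c d : Fin n → ℝ) (k : ℕ) (A B : Finset (Fin n)) : ℝ :=
  (((B.card : ℝ) - k) * cost b c d A + ((k : ℝ) - A.card) * cost b c d B) /
    ((B.card : ℝ) - A.card)

/-- `(A, B)` is an optimal pair. -/
def OptimalPair {n : ℕ} (b c d : Fin n → ℝ) (k : ℕ) (A B : Finset (Fin n)) : Prop :=
  A.card < k ∧ k < B.card ∧ IsLeast (obj b c d '' Pk n k) (fpair b c d k A B)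

/-- `X` is simple: some optimal assignment for upgrading `X` assigns every
upgraded supplier to a customer with positive demand. -/
def SimpleSet {n : ℕ} (b c d : Fin n → ℝ) (X : Finset (Fin n)) : Prop :=
  ∃ π : Equiv.Perm (Fin n), assignCost b c d X π = cost b c d X ∧
    ∀ j, π j ∈ X → 0 < d j

/-- `(A, B)` is clean. -/
def Clean {n : ℕ} (b c : Fin n → ℝ) (A B : Finset (Fin n)) : Prop :=
  ∀ i ∈ symmDiff A B, ∀ i' ∈ symmDiff A B, ¬ (b i < b i' ∧ c i' < c i)

/-- `(A', B')` is a redistribution of `(A, B)` : the elements of `A ∆ B` are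
enumerated `e 0, e 1, …` with `b` and `c` both nondecreasing along the
enumeration, the elements with odd (0-based) index go to `A'` and those with
even (0-based) index go to `B'` (on top of `A ∩ B`). -/
def Redistribution {n : ℕ} (b c : Fin n → ℝ) (A B A' B' : Finset (Fin n)) : Prop :=
  ∃ (ℓ : ℕ) (e : Fin ℓ → Fin n), Function.Injective e ∧
    Finset.image e Finset.univ = symmDiff A B ∧
    Monotone (b ∘ e) ∧ Monotone (c ∘ e) ∧
    A' = (A ∩ B) ∪
      Finset.image e ((Finset.univ : Finset (Fin ℓ)).filter (fun s => (s : ℕ) % 2 = 1)) ∧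
    B' = (A ∩ B) ∪
      Finset.image e ((Finset.univ : Finset (Fin ℓ)).filter (fun s => (s : ℕ) % 2 = 0))

/-- The 0/1 point of the LP corresponding to assignment `π` with upgraded set `A`. -/
def chi {n : ℕ} (π : Equiv.Perm (Fin n)) (A : Finset (Fin n)) :
    (Fin n → Fin n → ℝ) × (Fin n → Fin n → ℝ) :=
  (fun i j => if π j = i ∧ i ∈ A then 1 else 0,
   fun i j => if π j = i ∧ i ∉ A then 1 else 0)

/-- `hval k'` : minimum of `cost X` over all `X` of cardinality `k'`. -/
def hval {n : ℕ} (b c d : Fin n → ℝ) (k' : ℕ) : ℝ :=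
  sInf {v | ∃ X : Finset (Fin n), X.card = k' ∧ cost b c d X = v}

end

/-- The total fraction of suppliers upgraded by a point of the LP. -/
def upgradeCount (n : ℕ) : ((Fin n → Fin n → ℝ) × (Fin n → Fin n → ℝ)) →ₗ[ℝ] ℝ where
  toFun p := ∑ i, ∑ j, p.1 i j
  map_add' p q := by simp [sum_add_distrib]
  map_smul' c p := by simp [mul_sum]

lemma upgradeCount_chi {n : ℕ} (π : Equiv.Perm (Fin n)) (A : Finset (Fin n)) :
    upgradeCount n (chi π A) = A.card := by
  simp [upgradeCount, chi, ite_and, ← Equiv.eq_symm_apply]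

lemma integral_chi {n : ℕ} (π : Equiv.Perm (Fin n)) (A : Finset (Fin n)) :
    Integral (chi π A) := by
  constructor <;> intro i j <;> dsimp only [chi] <;> split <;> simp

lemma chi_mem_Pk {n k : ℕ} (π : Equiv.Perm (Fin n)) (A : Finset (Fin n)) (hA : A.card ≤ k) :
    chi π A ∈ Pk n k := by
  have hsum (i j : Fin n) : (chi π A).1 i j + (chi π A).2 i j = if π j = i then 1 else 0 := by
    by_cases h : π j = i <;> by_cases hi : i ∈ A <;> simp [chi, h, hi]
  refine ⟨fun i j => ?_, fun i j => ?_, fun j => ?_, fun i => ?_, ?_⟩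
  · dsimp only [chi]; split <;> simp
  · dsimp only [chi]; split <;> simp
  · simp [hsum]
  · simp [hsum, ← Equiv.eq_symm_apply]
  · exact (upgradeCount_chi π A).trans_le (by exact_mod_cast hA)

lemma convex_Pk (n k : ℕ) : Convex ℝ (Pk n k) := by
  rintro p ⟨hp₁, hp₂, hp₃, hp₄, hp₅⟩ q ⟨hq₁, hq₂, hq₃, hq₄, hq₅⟩ a b ha hb hab
  have hsum (i j : Fin n) : (a • p + b • q).1 i j + (a • p + b • q).2 i j =
      a * (p.1 i j + p.2 i j) + b * (q.1 i j + q.2 i j) := by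
    simp; ring
  refine ⟨fun i j => ?_, fun i j => ?_, fun j => ?_, fun i => ?_, ?_⟩
  · exact add_nonneg (mul_nonneg ha (hp₁ i j)) (mul_nonneg hb (hq₁ i j))
  · exact add_nonneg (mul_nonneg ha (hp₂ i j)) (mul_nonneg hb (hq₂ i j))
  · simp only [hsum, sum_add_distrib (f := fun i => a * _), ← mul_sum, hp₃, hq₃, mul_one, hab]
  · simp only [hsum, sum_add_distrib (f := fun i => a * _), ← mul_sum, hp₄, hq₄, mul_one, hab]
  · change upgradeCount n (a • p + b • q) ≤ k
    rw [map_add, map_smul, map_smul]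
    exact convex_Iic (k : ℝ) hp₅ hq₅ ha hb hab

lemma sum_smul_chi_mem_Pk {n k : ℕ} (w : Equiv.Perm (Fin n) × Finset (Fin n) → ℝ)
    (hw : ∀ s, 0 ≤ w s) (hw₁ : ∑ s, w s = 1) (hwk : ∑ s, w s * s.2.card ≤ k) :
    ∑ s, w s • chi s.1 s.2 ∈ Pk n k := by
  have h : ∑ s, w s • chi s.1 s.2 ∈ Pk n n :=
    (convex_Pk n n).sum_mem (fun s _ => hw s) hw₁
      fun s _ => chi_mem_Pk s.1 s.2 (by simpa using s.2.card_le_univ)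
  refine ⟨h.1, h.2.1, h.2.2.1, h.2.2.2.1, ?_⟩
  change upgradeCount n _ ≤ k
  simpa [upgradeCount_chi] using hwk

/-- The fractional upgrade of the assignment `π` that upgrades each supplier `i` by `t i`. -/
def fractionalChi {n : ℕ} (π : Equiv.Perm (Fin n)) (t : Fin n → ℝ) :
    (Fin n → Fin n → ℝ) × (Fin n → Fin n → ℝ) :=
  (fun i j => if π j = i then t i else 0, fun i j => if π j = i then 1 - t i else 0)

lemma fractionalChi_mem_convexHull {n : ℕ} (π : Equiv.Perm (Fin n)) (t : Fin n → ℝ)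
    (ht : ∀ i, t i ∈ Set.Icc (0 : ℝ) 1) :
    fractionalChi π t ∈ convexHull ℝ (Set.range
      fun s : Equiv.Perm (Fin n) × Finset (Fin n) => chi s.1 s.2) := by
  have hcube : t ∈ convexHull ℝ (Set.univ.pi fun _ : Fin n => ({0, 1} : Set ℝ)) := by
    rw [convexHull_pi]
    intro i _
    rw [convexHull_pair, segment_eq_Icc zero_le_one]
    exact ht i
  have hconv : Convex ℝ (fractionalChi π ⁻¹' convexHull ℝ (Set.range
      fun s : Equiv.Perm (Fin n) × Finset (Fin n) => chi s.1 s.2)) := by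
    intro t₁ h₁ t₂ h₂ a b ha hb hab
    have := convex_convexHull ℝ _ h₁ h₂ ha hb hab
    rw [Set.mem_preimage]
    convert this using 1
    ext i j <;> by_cases h : π j = i <;> simp [fractionalChi, h]
    linear_combination -hab
  refine convexHull_min ?_ hconv hcube
  intro t ht
  refine subset_convexHull ℝ _ ⟨(π, univ.filter fun i => t i = 1), ?_⟩
  have ht' (i : Fin n) : t i = 0 ∨ t i = 1 := by simpa using ht i (Set.mem_univ i)
  ext i j <;> rcases ht' i with hi | hi <;> simp [chi, fractionalChi, hi]

lemma mem_convexHull_chi {n k : ℕ} {p : (Fin n → Fin n → ℝ) × (Fin n → Fin n → ℝ)}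
    (hp : p ∈ Pk n k) :
    p ∈ convexHull ℝ (Set.range
      fun s : Equiv.Perm (Fin n) × Finset (Fin n) => chi s.1 s.2) := by
  obtain ⟨hx, hy, hcol, hrow, -⟩ := hp
  let M : Matrix (Fin n) (Fin n) ℝ := fun j i => p.1 i j + p.2 i j
  have hM : M ∈ doublyStochastic ℝ (Fin n) :=
    mem_doublyStochastic_iff_sum.2 ⟨fun j i => add_nonneg (hx i j) (hy i j), hcol, hrow⟩
  obtain ⟨w, hw, hw₁, hwM⟩ := exists_eq_sum_perm_of_mem_doublyStochastic hM
  have hentry (i j : Fin n) : ∑ σ, w σ * (if σ j = i then 1 else 0) = p.1 i j + p.2 i j := by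
    have := congr_fun (congr_fun hwM j) i
    simpa [Matrix.sum_apply, Equiv.toPEquiv_apply, M, PEquiv.toMatrix_apply, eq_comm] using this
  let r (i j : Fin n) : ℝ := p.1 i j / (p.1 i j + p.2 i j)
  have hr (i j : Fin n) : r i j ∈ Set.Icc (0 : ℝ) 1 :=
    ⟨div_nonneg (hx i j) (add_nonneg (hx i j) (hy i j)),
      div_le_one_of_le₀ (le_add_of_nonneg_right (hy i j)) (add_nonneg (hx i j) (hy i j))⟩
  have hrx (i j : Fin n) : (p.1 i j + p.2 i j) * r i j = p.1 i j := by
    by_cases h : p.1 i j + p.2 i j = 0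
    · rw [h, zero_mul]; linarith [hx i j, hy i j]
    · exact mul_div_cancel₀ _ h
  have hpw : p = ∑ σ, w σ • fractionalChi σ fun i => r i (σ.symm i) := by
    ext i j
    · simp only [Prod.fst_sum, Finset.sum_apply, Prod.smul_fst, Pi.smul_apply, smul_eq_mul,
        fractionalChi]
      rw [← hrx i j, ← hentry i j, sum_mul]
      refine sum_congr rfl fun σ _ => ?_
      split_ifs with h
      · simp [← h]
      · simp
    · simp only [Prod.snd_sum, Finset.sum_apply, Prod.smul_snd, Pi.smul_apply, smul_eq_mul,
        fractionalChi]
      have hry : p.2 i j = (p.1 i j + p.2 i j) * (1 - r i j) := by linarith [hrx i j]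
      rw [hry, ← hentry i j, sum_mul]
      refine sum_congr rfl fun σ _ => ?_
      split_ifs with h
      · simp [← h]
      · simp
  rw [hpw]
  exact (convex_convexHull ℝ _).sum_mem (fun σ _ => hw σ) hw₁
    fun σ _ => fractionalChi_mem_convexHull σ _ fun i => hr i _

lemma exists_mem_stdSimplex_of_mem_convexHull_range {ι E : Type*} [Fintype ι] [AddCommGroup E]
    [Module ℝ E] {v : ι → E} {x : E} (hx : x ∈ convexHull ℝ (Set.range v)) :
    ∃ w ∈ stdSimplex ℝ ι, ∑ i, w i • v i = x := by
  classical
  have hv : Set.range v =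
      Fintype.linearCombination ℝ v '' Set.range fun i : ι => Pi.single i (1 : ℝ) := by
    rw [← Set.range_comp]
    congr 1
    ext i
    simp
  rwa [hv, ← LinearMap.image_convexHull, convexHull_rangle_single_eq_stdSimplex] at hx

lemma exists_pos_forall_mul_abs_le {ι : Type*} [Finite ι] (w u : ι → ℝ) (hw : ∀ s, 0 ≤ w s)
    (hu : ∀ s, w s = 0 → u s = 0) : ∃ ε > 0, ∀ s, ε * |u s| ≤ w s := by
  have h : ∀ᶠ ε in nhdsWithin (0 : ℝ) (Set.Ioi 0), ∀ s, ε * |u s| ≤ w s := by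
    refine Filter.eventually_all.2 fun s => ?_
    rcases (hw s).eq_or_lt with h | h
    · simp [hu s h.symm, ← h]
    · have : Filter.Tendsto (fun ε : ℝ => ε * |u s|) (nhdsWithin 0 (Set.Ioi 0)) (nhds 0) := by
        refine tendsto_nhdsWithin_of_tendsto_nhds ?_
        exact Continuous.tendsto' (by fun_prop) _ _ (by simp)
      exact (this.eventually_lt_const h).mono fun _ => le_of_lt
  obtain ⟨ε, hε, hpos⟩ := (h.and self_mem_nhdsWithin).exists
  exact ⟨ε, hpos, hε⟩

lemma sum_smul_chi_eq_zero_of_mem_extremePoints {n k : ℕ}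
    {w u : Equiv.Perm (Fin n) × Finset (Fin n) → ℝ}
    (hw : ∀ s, 0 ≤ w s) (hw₁ : ∑ s, w s = 1)
    (hext : ∑ s, w s • chi s.1 s.2 ∈ Set.extremePoints ℝ (Pk n k))
    (hu : ∀ s, w s = 0 → u s = 0) (hu₀ : ∑ s, u s = 0) (hu₁ : ∑ s, u s * s.2.card = 0) :
    ∑ s, u s • chi s.1 s.2 = 0 := by
  obtain ⟨ε, hε, hle⟩ := exists_pos_forall_mul_abs_le w u hw hu
  have hwk : ∑ s, w s * s.2.card ≤ k := by
    have h : upgradeCount n (∑ s, w s • chi s.1 s.2) ≤ k := hext.1.2.2.2.2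
    simpa [upgradeCount_chi] using h
  have key (δ : ℝ) (hδ : |δ| = ε) :
      ∑ s, w s • chi s.1 s.2 + δ • ∑ s, u s • chi s.1 s.2 ∈ Pk n k := by
    have := sum_smul_chi_mem_Pk (k := k) (fun s => w s + δ * u s) (fun s => ?_) ?_ ?_
    · simpa only [add_smul, sum_add_distrib, smul_sum, mul_smul] using this
    · have := neg_abs_le (δ * u s)
      rw [abs_mul, hδ] at this
      linarith [hle s]
    · rw [sum_add_distrib, ← mul_sum, hu₀, hw₁]; simp
    · simp only [add_mul, mul_assoc, sum_add_distrib, ← mul_sum, hu₁]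
      simpa using hwk
  have h := hext.2 (key ε (abs_of_pos hε)) (key (-ε) (by simp [abs_of_pos hε]))
    ⟨1 / 2, 1 / 2, by norm_num, by norm_num, by norm_num, by module⟩
  simpa [hε.ne'] using h

/-- a non-integral extreme point of `P(k)` is a convex
combination of two integral matchings upgrading fewer than `k` and more than
`k` suppliers, respectively. -/
theorem stmt3 (n : ℕ) (hn : 1 ≤ n) (k : ℕ)
    (p : (Fin n → Fin n → ℝ) × (Fin n → Fin n → ℝ))
    (hext : p ∈ Set.extremePoints ℝ (Pk n k))
    (hni : ¬ Integral p) :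
    ∃ lam : ℝ, 0 < lam ∧ lam < 1 ∧
      ∃ (πA πB : Equiv.Perm (Fin n)) (A B : Finset (Fin n)),
        A.card < k ∧ k < B.card ∧
        p = lam • chi πA A + (1 - lam) • chi πB B := by
  have hne (π : Equiv.Perm (Fin n)) (A : Finset (Fin n)) : p ≠ chi π A := by
    rintro rfl
    exact hni (integral_chi π A)
  obtain ⟨w, hw, hw₁, hwp⟩ : ∃ w : Equiv.Perm (Fin n) × Finset (Fin n) → ℝ,
      (∀ s, 0 ≤ w s) ∧ ∑ s, w s = 1 ∧ ∑ s, w s • chi s.1 s.2 = p := by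
    obtain ⟨w, hw, hwp⟩ := exists_mem_stdSimplex_of_mem_convexHull_range
      (mem_convexHull_chi hext.1)
    exact ⟨w, hw.1, hw.2, hwp⟩
  have hext' := hwp ▸ hext
  let S : Finset (Equiv.Perm (Fin n) × Finset (Fin n)) := univ.filter fun s => w s ≠ 0
  have hS : S.Nonempty := by
    by_contra h
    have h₀ (s) : w s = 0 := by
      by_contra hs
      exact h ⟨s, by simpa [S] using hs⟩
    simp [h₀] at hw₁
  obtain ⟨a, ha, hmin⟩ := S.exists_min_image (fun s => s.2.card) hS
  obtain ⟨b, hb, hmax⟩ := S.exists_max_image (fun s => s.2.card) hS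
  have hwS {s} (hs : s ∈ S) : w s ≠ 0 := by simpa [S] using hs
  have hcomb (r) (hr : r ∈ S) (c₁ c₂ c₃ : ℝ) (h₀ : c₁ + c₂ = c₃)
      (h₁ : c₁ * a.2.card + c₂ * b.2.card = c₃ * r.2.card) :
      c₁ • chi a.1 a.2 + c₂ • chi b.1 b.2 = c₃ • chi r.1 r.2 := by
    have := sum_smul_chi_eq_zero_of_mem_extremePoints hw hw₁ hext'
      (u := Pi.single a c₁ + Pi.single b c₂ - Pi.single r c₃) ?_ ?_ ?_
    · simpa [add_smul, sub_smul, sum_add_distrib, Pi.single_apply, ite_smul, sub_eq_zero]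
        using this
    · intro s hs
      have hsc (c) (hc : c ∈ S) : s ≠ c := by rintro rfl; exact hwS hc hs
      simp [hsc a ha, hsc b hb, hsc r hr]
    · simp [sum_add_distrib, h₀]
    · simpa [add_mul, sub_mul, sum_add_distrib, Pi.single_apply, ite_mul, sub_eq_zero] using h₁
  have hsumS {v : Equiv.Perm (Fin n) × Finset (Fin n) →
      (Fin n → Fin n → ℝ) × (Fin n → Fin n → ℝ)} (hv : ∀ r ∈ S, chi r.1 r.2 = v r) :
      p = ∑ s, w s • v s := by
    rw [← hwp]
    refine sum_congr rfl fun s _ => ?_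
    by_cases hs : w s = 0
    · simp [hs]
    · rw [hv s (by simpa [S] using hs)]
  rcases (hmin b hb).eq_or_lt with hab | hab
  · refine absurd ?_ (hne a.1 a.2)
    rw [hsumS (v := fun _ => chi a.1 a.2), ← sum_smul, hw₁, one_smul]
    intro r hr
    have har : a.2.card = r.2.card := (hmin r hr).antisymm (hab ▸ hmax r hr)
    simpa using (hcomb r hr 1 0 1 (by simp) (by simp [har])).symm
  have hD : (0 : ℝ) < b.2.card - a.2.card := sub_pos.2 (by exact_mod_cast hab)
  let c (s : Equiv.Perm (Fin n) × Finset (Fin n)) : ℝ :=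
    ((b.2.card : ℝ) - s.2.card) / (b.2.card - a.2.card)
  obtain ⟨lam, hlam⟩ : ∃ lam, lam = ∑ s, w s * c s := ⟨_, rfl⟩
  have hp : p = lam • chi a.1 a.2 + (1 - lam) • chi b.1 b.2 := by
    have h₁ : 1 - lam = ∑ s, w s * (1 - c s) := by
      simp only [mul_sub, sum_sub_distrib, mul_one, hw₁, hlam]
    rw [hsumS (v := fun s => c s • chi a.1 a.2 + (1 - c s) • chi b.1 b.2), h₁, hlam]
    · simp only [smul_add, smul_smul, sum_add_distrib, sum_smul]
    · intro r hr
      refine (one_smul ℝ _).symm.trans (hcomb r hr (c r) (1 - c r) 1 (by ring) ?_).symm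
      simp only [c]
      field_simp
      ring
  have hlam₀ : 0 ≤ lam := by
    rw [hlam]
    refine sum_nonneg fun s _ => ?_
    by_cases hs : w s = 0
    · simp [hs]
    · have : (s.2.card : ℝ) ≤ b.2.card := by exact_mod_cast hmax s (by simpa [S] using hs)
      exact mul_nonneg (hw s) (div_nonneg (sub_nonneg.2 this) hD.le)
  have hlam₁ : lam ≤ 1 := by
    rw [hlam, ← hw₁]
    refine sum_le_sum fun s _ => ?_
    by_cases hs : w s = 0
    · simp [hs]
    · have : (a.2.card : ℝ) ≤ s.2.card := by exact_mod_cast hmin s (by simpa [S] using hs)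
      exact mul_le_of_le_one_right (hw s) ((div_le_one hD).2 (by linarith))
  have hpos : 0 < lam := hlam₀.lt_of_ne' fun h => hne b.1 b.2 (by simp [hp, h])
  have hlt : lam < 1 := hlam₁.lt_of_ne fun h => hne a.1 a.2 (by simp [hp, h])
  have hpk : lam * a.2.card + (1 - lam) * b.2.card ≤ k := by
    have h : upgradeCount n p ≤ k := hext.1.2.2.2.2
    simpa [hp, upgradeCount_chi] using h
  have hak : a.2.card < k := by
    have : (a.2.card : ℝ) < k := by nlinarith
    exact_mod_cast this
  refine ⟨lam, hpos, hlt, a.1, b.1, a.2, b.2, hak, ?_, hp⟩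
  by_contra! hbk
  exact hne a.1 a.2 (hext.2 (chi_mem_Pk a.1 a.2 hak.le) (chi_mem_Pk b.1 b.2 hbk)
    ⟨lam, 1 - lam, hpos, sub_pos.2 hlt, by ring, hp.symm⟩).symm
end

section
/- If (A, B) is an optimal pair and both A and B are simple, then (A, B) is clean. -/
open Finset

/-- The objective of the LP point of an assignment is the cost of the assignment. -/
theorem obj_chi {n : ℕ} (b c d : Fin n → ℝ) (π : Equiv.Perm (Fin n)) (X : Finset (Fin n)) :
    obj b c d (chi π X) = assignCost b c d X π := by
  unfold obj assignCost
  rw [Finset.sum_comm]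
  refine Finset.sum_congr rfl fun j _ => ?_
  rw [Finset.sum_eq_single (π j)]
  · by_cases h : π j ∈ X <;> simp [chi, h]
  · intro i _ hi
    simp [chi, hi.symm]
  · simp

theorem chi_mem_Pk_card {n : ℕ} (π : Equiv.Perm (Fin n)) (X : Finset (Fin n)) :
    chi π X ∈ Pk n X.card := by
  have key : ∀ i j, (chi π X).1 i j + (chi π X).2 i j = if π j = i then 1 else 0 := by
    intro i j
    by_cases h : π j = i <;> by_cases h' : i ∈ X <;> simp [chi, h, h']
  have hinv : ∀ i j, π j = i ↔ j = π.symm i := fun i j => by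
    rw [Equiv.eq_symm_apply]
  refine ⟨fun i j => ?_, fun i j => ?_, fun j => ?_, fun i => ?_, le_of_eq ?_⟩
  · simp only [chi]; split_ifs <;> norm_num
  · simp only [chi]; split_ifs <;> norm_num
  · simp [key]
  · simp [key, hinv]
  · simp [chi, hinv, ite_and]

theorem obj_smul_add_smul {n : ℕ} (b c d : Fin n → ℝ) (s t : ℝ)
    (p q : (Fin n → Fin n → ℝ) × (Fin n → Fin n → ℝ)) :
    obj b c d (s • p + t • q) = s * obj b c d p + t * obj b c d q := by
  simp only [obj, Finset.mul_sum, ← Finset.sum_add_distrib]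
  refine Finset.sum_congr rfl fun i _ => Finset.sum_congr rfl fun j _ => ?_
  simp only [Prod.fst_add, Prod.snd_add, Prod.smul_fst, Prod.smul_snd, Pi.add_apply,
    Pi.smul_apply, smul_eq_mul]
  ring

theorem smul_add_smul_mem_Pk {n k l m : ℕ} {s t : ℝ} (hs : 0 ≤ s) (ht : 0 ≤ t) (hst : s + t = 1)
    (hk : s * l + t * m ≤ k) {p q : (Fin n → Fin n → ℝ) × (Fin n → Fin n → ℝ)}
    (hp : p ∈ Pk n l) (hq : q ∈ Pk n m) : s • p + t • q ∈ Pk n k := by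
  obtain ⟨p1, p2, p3, p4, p5⟩ := hp
  obtain ⟨q1, q2, q3, q4, q5⟩ := hq
  have split : ∀ i j, (s • p + t • q).1 i j + (s • p + t • q).2 i j =
      s * (p.1 i j + p.2 i j) + t * (q.1 i j + q.2 i j) := fun i j => by
    simp only [Prod.fst_add, Prod.snd_add, Prod.smul_fst, Prod.smul_snd, Pi.add_apply,
      Pi.smul_apply, smul_eq_mul]
    ring
  refine ⟨fun i j => ?_, fun i j => ?_, fun j => ?_, fun i => ?_, ?_⟩
  · exact add_nonneg (mul_nonneg hs (p1 i j)) (mul_nonneg ht (q1 i j))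
  · exact add_nonneg (mul_nonneg hs (p2 i j)) (mul_nonneg ht (q2 i j))
  · simp only [split, Finset.sum_add_distrib (f := fun i => s * _), ← Finset.mul_sum, p3, q3]
    linarith
  · simp only [split, Finset.sum_add_distrib (f := fun i => s * _), ← Finset.mul_sum, p4, q4]
    linarith
  · have : ∑ i, ∑ j, (s • p + t • q).1 i j = s * ∑ i, ∑ j, p.1 i j + t * ∑ i, ∑ j, q.1 i j := by
      simp [Finset.sum_add_distrib, Finset.mul_sum]
    rw [this]
    exact le_trans (add_le_add (mul_le_mul_of_nonneg_left p5 hs)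
      (mul_le_mul_of_nonneg_left q5 ht)) hk

/-- If supplier `i` has smaller upgraded cost and larger original cost than `i'`, then an LP point
which partly upgrades `i'` for a customer of positive demand and partly uses `i` without upgrade
can be strictly improved by exchanging the two suppliers there. -/
theorem exists_obj_lt_of_dominated {n k : ℕ} {b c d : Fin n → ℝ} (hd : ∀ j, 0 ≤ d j)
    {p : (Fin n → Fin n → ℝ) × (Fin n → Fin n → ℝ)} (hp : p ∈ Pk n k) {i i' t s : Fin n}
    (hbi : b i < b i') (hci : c i' < c i) (hx : 0 < p.1 i' t) (hy : 0 < p.2 i s)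
    (ht : 0 < d t) : ∃ q ∈ Pk n k, obj b c d q < obj b c d p := by
  obtain ⟨p1, p2, p3, p4, p5⟩ := hp
  have hne : i ≠ i' := fun h => by simp [h] at hbi
  obtain ⟨ε, hε, hεx, hεy⟩ : ∃ ε : ℝ, 0 < ε ∧ ε ≤ p.1 i' t ∧ ε ≤ p.2 i s :=
    ⟨min (p.1 i' t) (p.2 i s), lt_min hx hy, min_le_left _ _, min_le_right _ _⟩
  let u : Fin n → ℝ := Pi.single i ε - Pi.single i' ε
  have hu : ∑ i, u i = 0 := by simp [u, Finset.sum_sub_distrib]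
  have hfu : ∀ f : Fin n → ℝ, ∑ l, f l * u l = (f i - f i') * ε := fun f => by
    simp [u, mul_sub, Finset.sum_sub_distrib, Pi.single_apply, sub_mul]
  let e : Fin n → Fin n → ℝ := fun t => Pi.single t 1
  have he : ∀ t, ∑ j, e t j = 1 := fun t => by simp [e]
  have hed : ∀ t, ∑ j, e t j * d j = d t := fun t => by simp [e, Pi.single_apply]
  have hui : u i = ε := by simp [u, hne]
  have hui' : u i' = -ε := by simp [u, hne.symm]
  have hul : ∀ l, l ≠ i → l ≠ i' → u l = 0 := fun l h h' => by simp [u, h, h']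
  have ex : ∀ l j, 0 ≤ p.1 l j + u l * e t j := by
    intro l j
    have := p1 l j
    by_cases hj : j = t
    · subst hj
      have hee : e j j = 1 := by simp [e]
      rw [hee]
      by_cases h : l = i
      · subst h; linarith
      · by_cases h' : l = i'
        · subst h'; linarith
        · rw [hul l h h']; linarith
    · have hee : e t j = 0 := by simp [e, hj]
      rw [hee]; linarith
  have ey : ∀ l j, 0 ≤ p.2 l j - u l * e s j := by
    intro l j
    have := p2 l j
    by_cases hj : j = s
    · subst hj
      have hee : e j j = 1 := by simp [e]
      rw [hee]
      by_cases h : l = i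
      · subst h; linarith
      · by_cases h' : l = i'
        · subst h'; linarith
        · rw [hul l h h']; linarith
    · have hee : e s j = 0 := by simp [e, hj]
      rw [hee]; linarith
  refine ⟨(fun l j => p.1 l j + u l * e t j, fun l j => p.2 l j - u l * e s j),
    ⟨ex, ey, fun j => ?_, fun l => ?_, ?_⟩, ?_⟩
  · have : ∀ l, (p.1 l j + u l * e t j) + (p.2 l j - u l * e s j) =
        (p.1 l j + p.2 l j) + u l * (e t j - e s j) := fun l => by ring
    simp only [this]
    rw [Finset.sum_add_distrib, p3, ← Finset.sum_mul, hu]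
    ring
  · have : ∀ j, (p.1 l j + u l * e t j) + (p.2 l j - u l * e s j) =
        (p.1 l j + p.2 l j) + u l * (e t j - e s j) := fun j => by ring
    simp only [this]
    rw [Finset.sum_add_distrib, p4, ← Finset.mul_sum, Finset.sum_sub_distrib, he, he]
    ring
  · simp only [Finset.sum_add_distrib, ← Finset.mul_sum, he, mul_one, hu, add_zero]
    exact p5
  · have hobj : obj b c d (fun l j => p.1 l j + u l * e t j, fun l j => p.2 l j - u l * e s j) =
        obj b c d p + ((∑ l, b l * u l) * d t - (∑ l, c l * u l) * d s) := by
      rw [← hed t, ← hed s]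
      simp only [obj, Finset.sum_mul_sum, ← Finset.sum_sub_distrib, ← Finset.sum_add_distrib]
      refine Finset.sum_congr rfl fun i _ => Finset.sum_congr rfl fun j _ => ?_
      ring
    rw [hobj, hfu, hfu]
    have h1 : 0 < (b i' - b i) * ε * d t := mul_pos (mul_pos (sub_pos.2 hbi) hε) ht
    have h2 : 0 ≤ (c i - c i') * ε * d s := mul_nonneg (mul_pos (sub_pos.2 hci) hε).le (hd s)
    linarith

/-- an optimal pair of simple sets is clean. -/
theorem stmt5 (n : ℕ) (hn : 1 ≤ n) (b c d : Fin n → ℝ)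
    (hb : ∀ i, 0 ≤ b i) (hbc : ∀ i, b i ≤ c i) (hd : ∀ j, 0 ≤ d j) (k : ℕ)
    (A B : Finset (Fin n)) (hopt : OptimalPair b c d k A B)
    (hA : SimpleSet b c d A) (hB : SimpleSet b c d B) :
    Clean b c A B := by
  obtain ⟨hAk, hkB, -, hmin⟩ := hopt
  obtain ⟨σ, hσ, hσd⟩ := hA
  obtain ⟨τ, hτ, hτd⟩ := hB
  rintro i hi i' hi' ⟨hbi, hci⟩
  have hAk' : (A.card : ℝ) < k := by exact_mod_cast hAk
  have hkB' : (k : ℝ) < B.card := by exact_mod_cast hkB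
  have hAB : (0 : ℝ) < B.card - A.card := by linarith
  let s : ℝ := ((B.card : ℝ) - k) / (B.card - A.card)
  let t : ℝ := ((k : ℝ) - A.card) / (B.card - A.card)
  have hs : 0 < s := div_pos (by linarith) hAB
  have ht : 0 < t := div_pos (by linarith) hAB
  have hst : s + t = 1 := by
    simp only [s, t]; field_simp; ring
  have hk : s * A.card + t * B.card = k := by
    simp only [s, t]; field_simp; ring
  have hmem := smul_add_smul_mem_Pk hs.le ht.le hst hk.le (chi_mem_Pk_card σ A)
    (chi_mem_Pk_card τ B)
  have hval : obj b c d (s • chi σ A + t • chi τ B) = fpair b c d k A B := by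
    rw [obj_smul_add_smul, obj_chi, obj_chi, hσ, hτ]
    simp only [s, t, fpair]; field_simp
  have hx : ∃ j, 0 < d j ∧ 0 < (s • chi σ A + t • chi τ B).1 i' j := by
    rcases Finset.mem_symmDiff.1 hi' with ⟨h, -⟩ | ⟨h, -⟩
    · exact ⟨σ.symm i', hσd _ (by simpa using h), add_pos_of_pos_of_nonneg
        (by simpa [chi, h] using hs) (mul_nonneg ht.le ((chi_mem_Pk_card τ B).1 _ _))⟩
    · exact ⟨τ.symm i', hτd _ (by simpa using h), add_pos_of_nonneg_of_pos
        (mul_nonneg hs.le ((chi_mem_Pk_card σ A).1 _ _)) (by simpa [chi, h] using ht)⟩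
  have hy : ∃ j, 0 < (s • chi σ A + t • chi τ B).2 i j := by
    rcases Finset.mem_symmDiff.1 hi with ⟨-, h⟩ | ⟨-, h⟩
    · exact ⟨τ.symm i, add_pos_of_nonneg_of_pos
        (mul_nonneg hs.le ((chi_mem_Pk_card σ A).2.1 _ _)) (by simpa [chi, h] using ht)⟩
    · exact ⟨σ.symm i, add_pos_of_pos_of_nonneg
        (by simpa [chi, h] using hs) (mul_nonneg ht.le ((chi_mem_Pk_card τ B).2.1 _ _))⟩
  obtain ⟨j, hdj, hxj⟩ := hx
  obtain ⟨j', hyj⟩ := hy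
  obtain ⟨q, hq, hlt⟩ := exists_obj_lt_of_dominated hd hmem hbi hci hxj hyj hdj
  rw [hval] at hlt
  exact hlt.not_ge (hmin ⟨q, hq, rfl⟩)
end
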